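/- For any real β > 0 and real ω, 1/(1 + e^{βω}) = 1/2 + (i/β) ∫_0^∞ (e^{iωt} − e^{−iωt})/(e^{πt/β} − e^{−πt/β}) dt. -/

import Mathlib

open Real MeasureTheory

/-- The summands of the series expansion of the integrand. -/
noncomputable def fermiTerm (a ω : ℝ) (n : ℕ) (t : ℝ) : ℂ :=
  Complex.exp ((-((2 * n + 1) * a) + Complex.I * ω) * t)
    - Complex.exp ((-((2 * n + 1) * a) - Complex.I * ω) * t)

lemma fermi_re1 (a ω : ℝ) (ha : 0 < a) (n : ℕ) :
    (-((2 * n + 1) * a) + Complex.I * ω : ℂ).re < 0 := by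
  have : (-((2 * n + 1) * a) + Complex.I * ω : ℂ).re = -((2 * n + 1) * a) := by simp
  rw [this]
  have : 0 < (2 * (n : ℝ) + 1) * a := by positivity
  linarith

lemma fermi_re2 (a ω : ℝ) (ha : 0 < a) (n : ℕ) :
    (-((2 * n + 1) * a) - Complex.I * ω : ℂ).re < 0 := by
  have h := fermi_re1 a (-ω) ha n
  have e : (-((2 * n + 1) * a) - Complex.I * ω : ℂ)
      = -((2 * n + 1) * a) + Complex.I * ((-ω : ℝ) : ℂ) := by push_cast; ring
  rw [e]
  exact h

lemma fermiTerm_integrable (a ω : ℝ) (ha : 0 < a) (n : ℕ) :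
    Integrable (fermiTerm a ω n) (volume.restrict (Set.Ioi 0)) :=
  Integrable.sub (integrableOn_exp_mul_complex_Ioi (fermi_re1 a ω ha n) 0)
    (integrableOn_exp_mul_complex_Ioi (fermi_re2 a ω ha n) 0)

lemma fermiTerm_integral (a ω : ℝ) (ha : 0 < a) (n : ℕ) :
    ∫ t in Set.Ioi (0:ℝ), fermiTerm a ω n t
      = -(1 / (a : ℂ)) * (1 / (Complex.I * ω / a - ((2 * n : ℕ) + 1))
        + 1 / (Complex.I * ω / a + ((2 * n : ℕ) + 1))) := by
  unfold fermiTerm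
  rw [integral_sub (integrableOn_exp_mul_complex_Ioi (fermi_re1 a ω ha n) 0)
    (integrableOn_exp_mul_complex_Ioi (fermi_re2 a ω ha n) 0),
    integral_exp_mul_complex_Ioi (fermi_re1 a ω ha n),
    integral_exp_mul_complex_Ioi (fermi_re2 a ω ha n)]
  have ha' : (a : ℂ) ≠ 0 := by exact_mod_cast ha.ne'
  have h1 : (-((2 * n + 1) * a) + Complex.I * ω : ℂ) ≠ 0 := by
    intro h
    have := fermi_re1 a ω ha n
    rw [h] at this
    simp at this
  have h2 : (-((2 * n + 1) * a) - Complex.I * ω : ℂ) ≠ 0 := by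
    intro h
    have := fermi_re2 a ω ha n
    rw [h] at this
    simp at this
  have e1 : (Complex.I * ω / a - ((2 * n : ℕ) + 1) : ℂ)
      = (-((2 * n + 1) * a) + Complex.I * ω) / a := by
    push_cast
    field_simp
    ring
  have e2 : (Complex.I * ω / a + ((2 * n : ℕ) + 1) : ℂ)
      = -((-((2 * n + 1) * a) - Complex.I * ω) / a) := by
    push_cast
    field_simp
    ring
  rw [e1, e2]
  generalize (-((2 * n + 1) * a) + Complex.I * ω : ℂ) = x at *
  generalize (-((2 * n + 1) * a) - Complex.I * ω : ℂ) = y at *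
  simp only [Complex.ofReal_zero, mul_zero, Complex.exp_zero]
  field_simp
  ring

lemma fermiTerm_norm_le (a ω : ℝ) (n : ℕ) (t : ℝ) (ht : 0 < t) :
    ‖fermiTerm a ω n t‖ ≤ 2 * |ω| * (t ^ ((2:ℝ) - 1) * Real.exp (-(((2 * n + 1) * a) * t))) := by
  have e : fermiTerm a ω n t = Complex.exp ((-((2 * n + 1) * a) - Complex.I * ω) * t)
      * (Complex.exp (Complex.I * ((2 * ω * t : ℝ) : ℂ)) - 1) := by
    unfold fermiTerm
    rw [mul_sub, ← Complex.exp_add, mul_one]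
    congr 2
    push_cast
    ring
  have en : ‖Complex.exp ((-((2 * n + 1) * a) - Complex.I * ω) * t)‖
      = Real.exp (-(((2 * n + 1) * a) * t)) := by
    rw [Complex.norm_exp]
    congr 1
    simp
  rw [e, norm_mul, en]
  have h := Real.norm_exp_I_mul_ofReal_sub_one_le (x := 2 * ω * t)
  have h2 : ‖2 * ω * t‖ = 2 * |ω| * t := by
    simp [abs_of_pos ht]
  rw [h2] at h
  have h3 : t ^ ((2:ℝ) - 1) = t := by norm_num
  rw [h3]
  calc _ ≤ Real.exp (-(((2 * n + 1) * a) * t)) * (2 * |ω| * t) := by gcongr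
    _ = _ := by ring

lemma fermi_summable (a ω : ℝ) (ha : 0 < a) :
    Summable fun n : ℕ => ∫ t in Set.Ioi (0:ℝ), ‖fermiTerm a ω n t‖ := by
  have hs : Summable fun n : ℕ => (2 * |ω| / a ^ 2) * (1 / ((n + 1 : ℕ) : ℝ) ^ 2) :=
    ((summable_nat_add_iff 1).mpr (Real.summable_one_div_nat_pow.mpr one_lt_two)).mul_left _
  refine Summable.of_nonneg_of_le (fun n => integral_nonneg fun t => norm_nonneg _) (fun n => ?_) hs
  have hc : 0 < (2 * (n : ℝ) + 1) * a := by positivity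
  have hI := Real.integral_rpow_mul_exp_neg_mul_Ioi (a := 2) two_pos hc
  have hint : IntegrableOn (fun t : ℝ => t ^ ((2:ℝ) - 1) *
      Real.exp (-(((2 * n + 1) * a) * t))) (Set.Ioi 0) := by
    have := integrableOn_rpow_mul_exp_neg_mul_rpow (p := 1) (s := 2 - 1) (b := (2 * (n : ℝ) + 1) * a)
      (by norm_num) one_pos hc
    simpa using this
  calc ∫ t in Set.Ioi (0:ℝ), ‖fermiTerm a ω n t‖
      ≤ ∫ t in Set.Ioi (0:ℝ), 2 * |ω| * (t ^ ((2:ℝ) - 1) *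
          Real.exp (-(((2 * n + 1) * a) * t))) :=
        setIntegral_mono_on (fermiTerm_integrable a ω ha n).norm (hint.const_mul _)
          measurableSet_Ioi (fun t ht => fermiTerm_norm_le a ω n t ht)
    _ = 2 * |ω| * (1 / ((2 * n + 1) * a)) ^ 2 := by
        rw [integral_const_mul, hI]
        simp
    _ = (2 * |ω| / a ^ 2) * (1 / (2 * (n : ℝ) + 1) ^ 2) := by
        field_simp
    _ ≤ _ := by
        gcongr
        push_cast
        linarith [(Nat.cast_nonneg n : (0:ℝ) ≤ n)]

lemma fermi_tsum (a ω t : ℝ) (ha : 0 < a) (ht : 0 < t) :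
    ∑' n, fermiTerm a ω n t
      = (Complex.exp (Complex.I * ω * t) - Complex.exp (-(Complex.I * ω * t)))
            / (Complex.exp ((a * t : ℝ)) - Complex.exp ((-(a * t) : ℝ))) := by
  set q : ℂ := Complex.exp ((-(a * t) : ℝ)) with hq
  have hq0 : q ≠ 0 := Complex.exp_ne_zero _
  have hqi : Complex.exp ((a * t : ℝ)) = q⁻¹ := by
    rw [hq, ← Complex.exp_neg]
    push_cast
    ring_nf
  have hqn : ‖q ^ 2‖ < 1 := by
    rw [norm_pow, hq, Complex.norm_exp]
    have : Real.exp (-(a * t)) < 1 := by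
      rw [← Real.exp_zero]
      exact Real.exp_lt_exp.mpr (by linarith [mul_pos ha ht])
    rw [Complex.ofReal_re]
    exact pow_lt_one₀ (Real.exp_pos _).le this two_ne_zero
  have hterm : ∀ n, fermiTerm a ω n t
      = ((Complex.exp (Complex.I * ω * t) - Complex.exp (-(Complex.I * ω * t))) * q) * (q ^ 2) ^ n := by
    intro n
    have : (q * (q ^ 2) ^ n) = Complex.exp (-((2 * n + 1) * a) * t) := by
      rw [← pow_mul, ← pow_succ', hq, ← Complex.exp_nat_mul]
      congr 1
      push_cast
      ring
    rw [mul_assoc, this, sub_mul, ← Complex.exp_add, ← Complex.exp_add]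
    unfold fermiTerm
    congr 2 <;> ring
  simp_rw [hterm]
  rw [tsum_mul_left, tsum_geometric_of_norm_lt_one hqn, hqi]
  have h1 : 1 - q ^ 2 ≠ 0 := by
    intro h
    have : q ^ 2 = 1 := by linear_combination -h
    rw [this] at hqn
    simp at hqn
  have h2 : q⁻¹ - q = (1 - q ^ 2) / q := by field_simp
  rw [h2]
  field_simp

lemma tsum_split_aux (g : ℕ → ℂ) (hs : Summable g) :
    ∑' n, g (2 * n) + ∑' n, g (2 * n + 1) = ∑' n, g n := by
  have he : Summable fun n => g (2 * n) :=
    hs.comp_injective (i := fun n : ℕ => 2 * n) (fun a b h => by simpa using h)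
  have ho : Summable fun n => g (2 * n + 1) :=
    hs.comp_injective (i := fun n : ℕ => 2 * n + 1) (fun a b h => by simpa using h)
  exact tsum_even_add_odd he ho

lemma cot_odd_sum (x : ℂ) (hx : x ∈ Complex.integerComplement)
    (hx2 : x / 2 ∈ Complex.integerComplement) :
    ∑' n : ℕ, (1 / (x - ((2 * n : ℕ) + 1)) + 1 / (x + ((2 * n : ℕ) + 1)))
      = π * Complex.cot (π * x) - π / 2 * Complex.cot (π * (x / 2)) := by
  have hs : Summable fun n : ℕ => (1 / (x - (n + 1)) + 1 / (x + (n + 1))) := summable_cotTerm hx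
  have h1 := cot_series_rep' hx
  have h2 := cot_series_rep' hx2
  have hx0 : x ≠ 0 := Complex.integerComplement.ne_zero hx
  have h3 := tsum_split_aux _ hs
  have h4 : ∑' k : ℕ, (1 / (x - ((2 * k + 1 : ℕ) + 1)) + 1 / (x + ((2 * k + 1 : ℕ) + 1)))
      = (1 / 2) * ∑' k : ℕ, (1 / (x / 2 - (k + 1)) + 1 / (x / 2 + (k + 1))) := by
    rw [← tsum_mul_left]
    refine tsum_congr fun k => ?_
    have e1 : x - ((2 * k + 1 : ℕ) + 1) = 2 * (x / 2 - (k + 1)) := by push_cast; ring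
    have e2 : x + ((2 * k + 1 : ℕ) + 1) = 2 * (x / 2 + (k + 1)) := by push_cast; ring
    rw [e1, e2]
    simp only [one_div, mul_inv]
    ring
  rw [h4, ← h1, ← h2] at h3
  have h5 : 1 / (x / 2) = 2 * (1 / x) := by field_simp
  rw [h5] at h3
  linear_combination h3

lemma fermi_mem (y : ℝ) (hy : y ≠ 0) : Complex.I * y ∈ Complex.integerComplement := by
  rw [Complex.mem_integerComplement_iff]
  rintro ⟨n, hn⟩
  have := congrArg Complex.im hn
  simp at this
  exact hy this.symm

theorem fermi_function_integral_rep (β ω : ℝ) (hβ : 0 < β) :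
    (1 : ℂ) / (1 + Complex.exp ((β : ℂ) * (ω : ℂ)))
      = 1 / 2 + (Complex.I / (β : ℂ)) *
        ∫ t in Set.Ioi (0:ℝ),
          (Complex.exp (Complex.I * ω * t) - Complex.exp (-(Complex.I * ω * t)))
            / (Complex.exp ((π * t / β : ℝ)) - Complex.exp ((-(π * t) / β : ℝ))) := by
  rcases eq_or_ne ω 0 with rfl | hω
  · simp; norm_num
  have ha : 0 < π / β := by positivity
  have hI : ∫ t in Set.Ioi (0:ℝ),
          (Complex.exp (Complex.I * ω * t) - Complex.exp (-(Complex.I * ω * t)))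
            / (Complex.exp ((π * t / β : ℝ)) - Complex.exp ((-(π * t) / β : ℝ)))
      = ∫ t in Set.Ioi (0:ℝ), ∑' n, fermiTerm (π / β) ω n t := by
    refine setIntegral_congr_fun measurableSet_Ioi fun t ht => ?_
    rw [fermi_tsum _ ω t ha ht]
    have e1 : π * t / β = π / β * t := by ring
    have e2 : -(π * t) / β = -(π / β * t) := by ring
    rw [e1, e2]
  have hS := (hasSum_integral_of_summable_integral_norm (fermiTerm_integrable _ ω ha)
    (fermi_summable _ ω ha)).tsum_eq
  rw [hI, ← hS]
  simp_rw [fermiTerm_integral _ ω ha]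
  have hx : (Complex.I * ω / (π / β : ℝ) : ℂ) = Complex.I * ((ω * β / π : ℝ) : ℂ) := by
    push_cast
    field_simp
  have hx2 : (Complex.I * ω / (π / β : ℝ) : ℂ) / 2 = Complex.I * ((ω * β / π / 2 : ℝ) : ℂ) := by
    rw [hx]
    push_cast
    ring
  have hπ : (π : ℂ) ≠ 0 := by exact_mod_cast Real.pi_ne_zero
  have hβ' : (β : ℂ) ≠ 0 := by exact_mod_cast hβ.ne'
  rw [tsum_mul_left, cot_odd_sum _ (by rw [hx]; exact fermi_mem _ (by positivity))
    (by rw [hx2]; exact fermi_mem _ (by positivity)), Complex.cot_pi_eq_exp_ratio,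
    Complex.cot_pi_eq_exp_ratio, hx2, hx]
  set E : ℂ := Complex.exp ((β : ℂ) * (ω : ℂ)) with hE
  have hEr : E = ((Real.exp (β * ω) : ℝ) : ℂ) := by
    rw [hE]; push_cast; rfl
  have hE0 : E ≠ 0 := Complex.exp_ne_zero _
  have hE1 : E - 1 ≠ 0 := by
    rw [hEr, sub_ne_zero]
    have : Real.exp (β * ω) ≠ 1 := by
      rw [Ne, Real.exp_eq_one_iff]
      positivity
    exact_mod_cast this
  have hE2 : 1 + E ≠ 0 := by
    rw [hEr]
    have : 1 + Real.exp (β * ω) ≠ 0 := by positivity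
    exact_mod_cast this
  have q1 : Complex.exp (2 * π * Complex.I * (Complex.I * ((ω * β / π / 2 : ℝ) : ℂ))) = E⁻¹ := by
    rw [hE, ← Complex.exp_neg]
    congr 1
    push_cast
    field_simp
    rw [Complex.I_sq]
    ring
  have q2 : Complex.exp (2 * π * Complex.I * (Complex.I * ((ω * β / π : ℝ) : ℂ))) = (E ^ 2)⁻¹ := by
    rw [hE, ← Complex.exp_nat_mul, ← Complex.exp_neg]
    congr 1
    push_cast
    field_simp
    rw [Complex.I_sq]
    ring
  rw [q1, q2]
  have r1 : (E⁻¹ + 1) / (Complex.I * (1 - E⁻¹)) = -Complex.I * ((1 + E) / (E - 1)) := by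
    have : 1 - E⁻¹ = (E - 1) / E := by field_simp
    rw [this]
    field_simp
    rw [Complex.I_sq]
    ring
  have r2 : ((E ^ 2)⁻¹ + 1) / (Complex.I * (1 - (E ^ 2)⁻¹))
      = -Complex.I * ((1 + E ^ 2) / ((E - 1) * (1 + E))) := by
    have : 1 - (E ^ 2)⁻¹ = ((E - 1) * (1 + E)) / E ^ 2 := by field_simp; ring
    rw [this]
    field_simp
    rw [Complex.I_sq]
    ring
  rw [r1, r2]
  push_cast
  field_simp
  rw [Complex.I_sq]
  ring
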